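/- Let X be a compact metric space, F : X → Set X a set-valued map with nonempty compact values that is upper semicontinuous, and let M ⊆ X be nonempty and compact with F(M) ⊆ M. If no proper nonempty compact subset M' ⊊ M satisfies F(M') ⊆ M', then M is F-invariant, i.e. F(M) = M. -/

import Mathlib

open Metric Set Filter Topology

/-- The extension of a set-valued map to subsets: `F(A) = ⋃_{x ∈ A} F(x)`. -/
def setImage {X : Type*} (F : X → Set X) (A : Set X) : Set X := ⋃ x ∈ A, F x

theorem setImage_mono {X : Type*} (F : X → Set X) {A B : Set X} (h : A ⊆ B) :
    setImage F A ⊆ setImage F B :=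
  biUnion_subset_biUnion_left h

theorem Set.Nonempty.setImage {X : Type*} {F : X → Set X} (hne : ∀ x, (F x).Nonempty)
    {A : Set X} (hA : A.Nonempty) : (setImage F A).Nonempty := by
  obtain ⟨a, ha⟩ := hA
  obtain ⟨b, hb⟩ := hne a
  exact ⟨b, mem_biUnion ha hb⟩

/-- A set-valued map with sequentially closed graph sends compact sets to closed sets. -/
theorem IsCompact.isClosed_setImage {X : Type*} [MetricSpace X] {F : X → Set X}
    (husc : ∀ (x y : ℕ → X) (a b : X), Tendsto x atTop (𝓝 a) →
      (∀ n, y n ∈ F (x n)) → Tendsto y atTop (𝓝 b) → b ∈ F a)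
    {A : Set X} (hA : IsCompact A) : IsClosed (setImage F A) := by
  refine IsSeqClosed.isClosed fun y b hy hb => ?_
  simp only [setImage, mem_iUnion, exists_prop] at hy
  choose x hxA hxy using hy
  obtain ⟨a, ha, φ, hφ, hxa⟩ := hA.tendsto_subseq hxA
  exact mem_biUnion ha
    (husc (x ∘ φ) (y ∘ φ) a b hxa (fun n => hxy (φ n)) (hb.comp hφ.tendsto_atTop))

/-- If `M` is nonempty compact with `F(M) ⊆ M`, and no proper nonempty
compact subset `M' ⊊ M` satisfies `F(M') ⊆ M'`, then `F(M) = M`. -/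
theorem forward_invariant_minimal_is_invariant {X : Type*} [MetricSpace X] [CompactSpace X]
    (F : X → Set X)
    (hne : ∀ x, (F x).Nonempty)
    (hcpt : ∀ x, IsCompact (F x))
    (husc : ∀ (x y : ℕ → X) (a b : X), Tendsto x atTop (𝓝 a) →
      (∀ n, y n ∈ F (x n)) → Tendsto y atTop (𝓝 b) → b ∈ F a)
    (M : Set X) (hMne : M.Nonempty) (hMc : IsCompact M)
    (hsub : setImage F M ⊆ M)
    (hmin : ∀ M' : Set X, M' ⊂ M → M'.Nonempty → IsCompact M' →
      ¬ setImage F M' ⊆ M') :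
    setImage F M = M := by
  by_contra hM
  exact hmin _ (hsub.ssubset_of_ne hM) (hMne.setImage hne)
    (hMc.isClosed_setImage husc).isCompact (setImage_mono F hsub)
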